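/- arXiv:2602.10232 — 2 statements merged into one kernel-verified Lean document; each statement's English description precedes it below -/
import Mathlib

section
/- Let Z be a type with a distinguished null record ⊥ and n a positive natural number. For a dataset D : Fin n → Z and index i, write D^(−i) = Function.update D i ⊥. Let W : Kernel (Fin n → Z) Ω₁ and A : Kernel (Ω₁ × (Fin n → Z)) Ω₂ be Markov kernels. Suppose that for all datasets D, all indices i, and all measurable S ⊆ Ω₁, (W D) S ≤ exp(ε_s) · (W D^(−i)) S + δ_s; and suppose that for every fixed w ∈ Ω₁, the fixed dataset D, and the index i, the per-instance bound holds: for all measurable T ⊆ Ω₂, (A (w, D)) T ≤ exp(ε_{i,t}) · (A (w, D^(−i))) T + δ_t. Then the composed mechanism M D = (W D).bind (fun w => ((A (w, D)).map (fun θ => (w, θ)))) satisfies the per-instance bound (ε_s + ε_{i,t}, δ_s + δ_t) for record i on D: for all measurable S ⊆ Ω₁ × Ω₂, (M D) S ≤ exp(ε_s + ε_{i,t}) · (M D^(−i)) S + (δ_s + δ_t). -/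
open MeasureTheory ProbabilityTheory

/-- Approximate domination of measures extends to `[0,1]`-valued test functions. -/
theorem lintegral_le_of_approx {Ω : Type*} [MeasurableSpace Ω] (μ ν : Measure Ω)
    [IsFiniteMeasure μ] [IsFiniteMeasure ν] (d : ENNReal)
    (h : ∀ S, MeasurableSet S → μ S ≤ ν S + d)
    (f : Ω → ENNReal) (hf1 : ∀ w, f w ≤ 1) :
    ∫⁻ w, f w ∂μ ≤ ∫⁻ w, f w ∂ν + d := by
  obtain ⟨s, hs, h1, h2⟩ := hahn_decomposition μ ν
  have hle : ν.restrict s ≤ μ.restrict s := by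
    refine Measure.le_iff.2 fun t ht => ?_
    rw [Measure.restrict_apply ht, Measure.restrict_apply ht]
    exact h1 _ (ht.inter hs) Set.inter_subset_right
  have hle2 : μ.restrict sᶜ ≤ ν.restrict sᶜ := by
    refine Measure.le_iff.2 fun t ht => ?_
    rw [Measure.restrict_apply ht, Measure.restrict_apply ht]
    exact h2 _ (ht.inter hs.compl) Set.inter_subset_right
  have hsub : ∫⁻ w in s, f w ∂μ ≤ ∫⁻ w in s, f w ∂ν + d := by
    have e := Measure.sub_add_cancel_of_le hle
    rw [← e, lintegral_add_measure, add_comm]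
    gcongr
    calc ∫⁻ w, f w ∂(μ.restrict s - ν.restrict s)
        ≤ ∫⁻ w, 1 ∂(μ.restrict s - ν.restrict s) := lintegral_mono hf1
      _ = (μ.restrict s - ν.restrict s) Set.univ := by simp
      _ ≤ d := by
        rw [Measure.sub_apply MeasurableSet.univ hle]
        simp only [Measure.restrict_apply_univ]
        exact tsub_le_iff_left.2 (h s hs)
  rw [← lintegral_add_compl f hs, ← lintegral_add_compl (μ := ν) f hs]
  calc _ ≤ (∫⁻ w in s, f w ∂ν + d) + ∫⁻ w in sᶜ, f w ∂ν :=
        add_le_add hsub (lintegral_mono' hle2 le_rfl)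
    _ = _ := by ring

theorem bind_map_apply_aux {Z Ω₁ Ω₂ : Type*} [MeasurableSpace Z] [MeasurableSpace Ω₁]
    [MeasurableSpace Ω₂] (μ : Measure Ω₁) (A : Kernel (Ω₁ × Z) Ω₂) [IsMarkovKernel A] (D : Z)
    (S : Set (Ω₁ × Ω₂)) (hS : MeasurableSet S) :
    Measurable (fun w => A (w, D) (Prod.mk w ⁻¹' S)) ∧
    (μ.bind (fun w => ((A (w, D)).map (fun θ => (w, θ))))) S
      = ∫⁻ w, A (w, D) (Prod.mk w ⁻¹' S) ∂μ := by
  have key : ∀ S : Set (Ω₁ × Ω₂), MeasurableSet S →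
      Measurable (fun w => A (w, D) (Prod.mk w ⁻¹' S)) := fun S hS =>
    Kernel.measurable_kernel_prodMk_left
      (κ := A.comap (fun w => (w, D)) measurable_prodMk_right) hS
  refine ⟨key S hS, ?_⟩
  have hap : ∀ w, ∀ S : Set (Ω₁ × Ω₂), MeasurableSet S →
      ((A (w, D)).map (fun θ => (w, θ))) S = A (w, D) (Prod.mk w ⁻¹' S) := fun w S hS =>
    Measure.map_apply measurable_prodMk_left hS
  rw [Measure.bind_apply hS]
  · exact lintegral_congr fun w => hap w S hS
  · refine (Measure.measurable_of_measurable_coe _ fun T hT => ?_).aemeasurable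
    simp only [hap _ T hT]
    exact key T hT

/-- End-to-end per-instance bound for the composed mechanism.
If the scorer `W` satisfies the `(ε_s, δ_s)` per-instance bound for every dataset and
index, and for the fixed dataset `D` and index `i` the learner `A (w, ·)` satisfies the
`(ε_{i,t}, δ_t)` per-instance bound for every fixed weight vector `w`, then the composed
mechanism satisfies the `(ε_s + ε_{i,t}, δ_s + δ_t)` per-instance bound for record `i` on `D`. -/
theorem reps_end_to_end_per_instance
    {Z Ω₁ Ω₂ : Type*} [MeasurableSpace Z] [MeasurableSpace Ω₁] [MeasurableSpace Ω₂]
    (nullz : Z) (n : ℕ) (hn : 0 < n)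
    (W : Kernel (Fin n → Z) Ω₁) (A : Kernel (Ω₁ × (Fin n → Z)) Ω₂)
    [IsMarkovKernel W] [IsMarkovKernel A]
    (εs εit δs δt : ℝ) (hεs : 0 ≤ εs) (hεit : 0 ≤ εit) (hδs : 0 ≤ δs) (hδt : 0 ≤ δt)
    (D : Fin n → Z) (i : Fin n)
    (hW : ∀ (E : Fin n → Z) (j : Fin n), ∀ S : Set Ω₁, MeasurableSet S →
      W E S ≤ ENNReal.ofReal (Real.exp εs) * W (Function.update E j nullz) S
        + ENNReal.ofReal δs)
    (hA : ∀ w : Ω₁, ∀ T : Set Ω₂, MeasurableSet T →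
      A (w, D) T ≤ ENNReal.ofReal (Real.exp εit) * A (w, Function.update D i nullz) T
        + ENNReal.ofReal δt) :
    ∀ S : Set (Ω₁ × Ω₂), MeasurableSet S →
      ((W D).bind (fun w => ((A (w, D)).map (fun θ => (w, θ))))) S ≤
        ENNReal.ofReal (Real.exp (εs + εit)) *
          ((W (Function.update D i nullz)).bind
            (fun w => ((A (w, Function.update D i nullz)).map (fun θ => (w, θ))))) S
        + ENNReal.ofReal (δs + δt) := by
  intro S hS
  obtain ⟨-, e1⟩ := bind_map_apply_aux (W D) A D S hS
  obtain ⟨m2, e2⟩ := bind_map_apply_aux (W (Function.update D i nullz)) A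
    (Function.update D i nullz) S hS
  rw [e1, e2]
  set D' := Function.update D i nullz with hD'
  set a := ENNReal.ofReal (Real.exp εs) with ha
  set b := ENNReal.ofReal (Real.exp εit) with hb
  have haT : a ≠ ⊤ := ENNReal.ofReal_ne_top
  have hbT : b ≠ ⊤ := ENNReal.ofReal_ne_top
  have hfin : IsFiniteMeasure (a • W D') := Measure.smul_finite _ haT
  have hpt : ∀ w, A (w, D) (Prod.mk w ⁻¹' S) ≤
      min 1 (b * A (w, D') (Prod.mk w ⁻¹' S)) + ENNReal.ofReal δt := by
    intro w
    rw [min_add]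
    exact le_min (prob_le_one.trans le_self_add) (hA w _ (measurable_prodMk_left hS))
  have h1 := lintegral_le_of_approx (W D) (a • W D') (ENNReal.ofReal δs)
    (fun T hT => by simpa using hW D i T hT)
    (fun w => min 1 (b * A (w, D') (Prod.mk w ⁻¹' S))) (fun w => min_le_left _ _)
  have h2 : ∫⁻ w, min 1 (b * A (w, D') (Prod.mk w ⁻¹' S)) ∂(W D') ≤
      b * ∫⁻ w, A (w, D') (Prod.mk w ⁻¹' S) ∂(W D') := by
    rw [← lintegral_const_mul _ m2]
    exact lintegral_mono fun w => min_le_right _ _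
  rw [lintegral_smul_measure, smul_eq_mul] at h1
  calc _ ≤ ∫⁻ w, (min 1 (b * A (w, D') (Prod.mk w ⁻¹' S)) + ENNReal.ofReal δt) ∂(W D) :=
        lintegral_mono hpt
    _ = ∫⁻ w, min 1 (b * A (w, D') (Prod.mk w ⁻¹' S)) ∂(W D) + ENNReal.ofReal δt := by
        rw [lintegral_add_right _ measurable_const]; simp
    _ ≤ (a * (b * ∫⁻ w, A (w, D') (Prod.mk w ⁻¹' S) ∂(W D')) + ENNReal.ofReal δs)
        + ENNReal.ofReal δt := by
        gcongr
        exact h1.trans (by gcongr)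
    _ = _ := by
        rw [Real.exp_add, ENNReal.ofReal_mul (Real.exp_pos _).le, ENNReal.ofReal_add hδs hδt,
          ← ha, ← hb]
        ring
end

section
/- Let Z be a type with a distinguished null record ⊥, n a positive natural number, C > 0, σ > 0, δ_t ∈ (0, 1), φ : Z → EuclideanSpace ℝ (Fin k) with φ(⊥) = 0, and weights w : Fin n → ℝ with 0 < w i ≤ 1. Define clip and the weighted clipped aggregate f_w(D) = (1/n) · Σ_i w i • clip(φ(D i), C), and let the mechanism M map D to the product Gaussian measure on Fin k → ℝ with mean vector f_w(D) and per-coordinate variance σ². Fix a dataset D and index i, set ε_i = (w i · C / (n · σ)) · √(2 · log(1.25 / δ_t)), and assume ε_i < 1. Then for every measurable set S ⊆ (Fin k → ℝ), (M D) S ≤ exp(ε_i) · (M D^(−i)) S + δ_t, where D^(−i) = Function.update D i ⊥. -/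
open MeasureTheory ProbabilityTheory

/-- ℓ₂ clipping of `u` to norm at most `C`: `clip u C = min(1, C/‖u‖) • u`
(so `clip 0 C = 0`, matching the convention `clip(0,C)=0` since `C/0 = 0` in Lean). -/
noncomputable def clip {k : ℕ} (u : EuclideanSpace ℝ (Fin k)) (C : ℝ) :
    EuclideanSpace ℝ (Fin k) :=
  (min 1 (C / ‖u‖)) • u

/-- Weighted clipped aggregate `f_w(D) = (1/n) Σ_i w_i • clip(φ(D_i), C)`. -/
noncomputable def fw {Z : Type*} {k n : ℕ} (φ : Z → EuclideanSpace ℝ (Fin k)) (C : ℝ)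
    (w : Fin n → ℝ) (D : Fin n → Z) : EuclideanSpace ℝ (Fin k) :=
  (1 / (n : ℝ)) • ∑ i, w i • clip (φ (D i)) C



lemma aux_gauss_density (a b : ℝ) (V : NNReal) (hV : V ≠ 0) :
    gaussianReal a V = (gaussianReal b V).withDensity
      (fun x => ENNReal.ofReal (Real.exp (((a-b)*(x-b) - (a-b)^2/2)/V))) := by
  rw [gaussianReal_of_var_ne_zero _ hV, gaussianReal_of_var_ne_zero _ hV,
    ← withDensity_mul _ (measurable_gaussianPDF _ _) (by fun_prop)]
  congr 1
  ext x
  have hV' : (V : ℝ) ≠ 0 := by exact_mod_cast hV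
  simp only [Pi.mul_apply, gaussianPDF, gaussianPDFReal]
  rw [← ENNReal.ofReal_mul (by positivity), mul_assoc (Real.sqrt _)⁻¹, ← Real.exp_add]
  congr 3
  field_simp
  ring

lemma aux_pi_density {k : ℕ} (ν : Fin k → Measure ℝ) [∀ j, IsProbabilityMeasure (ν j)]
    (g : Fin k → ℝ → ENNReal) (hg : ∀ j, Measurable (g j))
    [∀ j, SigmaFinite ((ν j).withDensity (g j))] :
    Measure.pi (fun j => (ν j).withDensity (g j)) =
      (Measure.pi ν).withDensity (fun x => ∏ j, g j (x j)) := by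
  refine Measure.pi_eq (fun s hs => ?_)
  rw [withDensity_apply _ (MeasurableSet.univ_pi hs),
    ← lintegral_indicator (MeasurableSet.univ_pi hs)]
  have hm : ∀ j, Measurable ((s j).indicator (g j)) := fun j => (hg j).indicator (hs j)
  have h1 : (Set.univ.pi s).indicator (fun x : Fin k → ℝ => ∏ j, g j (x j)) =
      fun x => ∏ j, (s j).indicator (g j) (x j) := by
    ext x
    by_cases hx : x ∈ Set.univ.pi s
    · rw [Set.indicator_of_mem hx]
      exact Finset.prod_congr rfl fun j _ => (Set.indicator_of_mem (hx j trivial) _).symm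
    · rw [Set.indicator_of_notMem hx]
      simp only [Set.mem_univ_pi, not_forall] at hx
      obtain ⟨j, hj⟩ := hx
      exact (Finset.prod_eq_zero (Finset.mem_univ j) (Set.indicator_of_notMem hj _)).symm
  rw [h1]
  rw [lintegral_prod_eq_prod_lintegral_of_indepFun Finset.univ
    (fun j (x : Fin k → ℝ) => (s j).indicator (g j) (x j))
    (iIndepFun_pi (X := fun j => (s j).indicator (g j)) fun j => (hm j).aemeasurable)
    (fun j => (hm j).comp (measurable_pi_apply j))]
  refine Finset.prod_congr rfl fun j _ => ?_
  rw [(measurePreserving_eval ν j).lintegral_comp (hm j), lintegral_indicator (hs j),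
    withDensity_apply _ (hs j)]

lemma aux_half : gaussianReal 0 1 (Set.Ioi 0) ≤ ENNReal.ofReal (1/2) := by
  have h : gaussianReal 0 1 (Set.Ioi 0) = gaussianReal 0 1 (Set.Iio 0) := by
    have := gaussianReal_map_neg (μ := 0) (v := 1)
    rw [neg_zero] at this
    conv_lhs => rw [← this, Measure.map_apply (by fun_prop) measurableSet_Ioi]
    congr 1
    ext x; simp
  have h2 : gaussianReal 0 1 (Set.Ioi 0) + gaussianReal 0 1 (Set.Iio 0) ≤ 1 := by
    rw [← measure_union (by
      rw [Set.disjoint_left]; intro x hx hx'; exact lt_asymm (Set.mem_Ioi.1 hx) (Set.mem_Iio.1 hx')) measurableSet_Iio]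
    exact prob_le_one
  rw [← h] at h2
  rw [ENNReal.le_ofReal_iff_toReal_le (measure_ne_top _ _) (by norm_num)]
  have h3 := ENNReal.toReal_mono (by simp) h2
  rw [ENNReal.toReal_add (measure_ne_top _ _) (measure_ne_top _ _)] at h3
  simp at h3 ⊢
  linarith

lemma aux_tail_pos (t : ℝ) (ht : 0 ≤ t) :
    gaussianReal 0 1 (Set.Ioi t) ≤ ENNReal.ofReal (Real.exp (-t^2/2) * (1/2)) := by
  have h1 : gaussianReal 0 1 (Set.Ioi t) = gaussianReal (0 - t) 1 (Set.Ioi 0) := by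
    rw [← gaussianReal_map_sub_const, Measure.map_apply (by fun_prop) measurableSet_Ioi]
    congr 1; ext x; simp
  rw [h1, aux_gauss_density (0-t) 0 1 one_ne_zero, withDensity_apply _ measurableSet_Ioi]
  calc _ ≤ ∫⁻ x in Set.Ioi 0, ENNReal.ofReal (Real.exp (-t^2/2)) ∂gaussianReal 0 1 := by
        refine setLIntegral_mono (by fun_prop) fun x hx => ?_
        apply ENNReal.ofReal_le_ofReal
        apply Real.exp_le_exp.2
        have : 0 ≤ t * x := mul_nonneg ht (le_of_lt hx)
        simp
        nlinarith
    _ = ENNReal.ofReal (Real.exp (-t^2/2)) * gaussianReal 0 1 (Set.Ioi 0) := by simp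
    _ ≤ _ := by
        rw [ENNReal.ofReal_mul (by positivity)]
        gcongr
        exact aux_half

lemma aux_tail_neg (t : ℝ) (ht : t ≤ 0) :
    gaussianReal 0 1 (Set.Ioi t) ≤ ENNReal.ofReal (-t + 1/2) := by
  have h1 : gaussianReal 0 1 (Set.Ioc t 0) ≤ ENNReal.ofReal (-t) := by
    rw [gaussianReal_apply _ one_ne_zero]
    calc _ ≤ ∫⁻ x in Set.Ioc t 0, 1 := by
          refine setLIntegral_mono (by fun_prop) fun x hx => ?_
          rw [gaussianPDF, ENNReal.ofReal_le_one, gaussianPDFReal]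
          apply mul_le_one₀
          · apply inv_le_one_of_one_le₀
            rw [Real.one_le_sqrt]
            have := Real.pi_gt_three
            simp; linarith
          · positivity
          · rw [Real.exp_le_one_iff]
            have : 0 ≤ (x - 0)^2 / (2 * ((1:NNReal):ℝ)) := by positivity
            rw [neg_div]
            linarith
      _ = _ := by simp
  rw [← Set.Ioc_union_Ioi_eq_Ioi ht, ENNReal.ofReal_add (by linarith) (by norm_num)]
  exact (measure_union_le _ _).trans (add_le_add h1 aux_half)

lemma aux_tail (c t : ℝ) (hc : 0 < c) (hc2 : 2 * Real.log 1.25 ≤ c^2)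
    (h : 2*c^2 - 1 ≤ 2*c*t) :
    gaussianReal 0 1 (Set.Ioi t) ≤ ENNReal.ofReal (1.25 * Real.exp (-c^2/2)) := by
  rcases le_total 0 t with ht | ht
  · refine (aux_tail_pos t ht).trans (ENNReal.ofReal_le_ofReal ?_)
    have h1 : Real.exp (-t^2/2) ≤ Real.exp (-c^2/2) * Real.exp (1/2) := by
      rw [← Real.exp_add]
      apply Real.exp_le_exp.2
      nlinarith [sq_nonneg (t-c)]
    have h2 : Real.exp (1/2) ≤ 2.5 := by
      have := Real.exp_one_lt_d9
      have h3 : Real.exp (1/2) ≤ Real.exp 1 := Real.exp_le_exp.2 (by norm_num)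
      have h4 : Real.exp (1/2) * Real.exp (1/2) = Real.exp 1 := by
        rw [← Real.exp_add]; norm_num
      nlinarith
    nlinarith [Real.exp_pos (-c^2/2)]
  · refine (aux_tail_neg t ht).trans (ENNReal.ofReal_le_ofReal ?_)
    have hl : 1 - (1.25:ℝ)⁻¹ ≤ Real.log 1.25 := Real.one_sub_inv_le_log_of_pos (by norm_num)
    norm_num at hl hc2
    have h0 : c^2 ≤ 1/2 := by nlinarith
    have h5 : 0.6 ≤ c := by nlinarith
    have h6 : 1 + (-c^2/2) ≤ Real.exp (-c^2/2) := by linarith [Real.add_one_le_exp (-c^2/2)]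
    have : -t ≤ 0.4 := by
      by_contra! h7
      nlinarith
    norm_num at *
    linarith

lemma aux_proj {k : ℕ} (a c : Fin k → ℝ) (V : NNReal) (h : ∑ j, c j ^ 2 * (V:ℝ) = 1) :
    (Measure.pi (fun j => gaussianReal (a j) V)).map (fun x => ∑ j, c j * (x j - a j))
      = gaussianReal 0 1 := by
  have hlaw : ∀ j, (gaussianReal (a j) V).map (fun y => c j * (y - a j)) =
      gaussianReal 0 (.mk (c j ^ 2) (sq_nonneg _) * V) := by
    intro j
    have : (fun y => c j * (y - a j)) = (fun y => c j * y) ∘ (fun y => y - a j) := rfl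
    rw [this, ← Measure.map_map (by fun_prop) (by fun_prop), gaussianReal_map_sub_const,
      gaussianReal_map_const_mul]
    simp
  have hmem : ∀ j, MemLp (fun y => c j * (y - a j)) 2 (gaussianReal (a j) V) := by
    intro j
    exact ((memLp_id_gaussianReal' 2 (by simp)).sub (memLp_const (a j))).const_mul (c j)
  have hmean : ∀ j, ∫ y, c j * (y - a j) ∂(gaussianReal (a j) V) = 0 := by
    intro j
    have h1 := integral_map (μ := gaussianReal (a j) V) (φ := fun y => c j * (y - a j))
      (f := fun y => y) (by fun_prop) (by fun_prop)
    rw [← h1, hlaw, integral_id_gaussianReal]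
  have hvar : ∀ j, Var[fun y => c j * (y - a j); gaussianReal (a j) V] = c j ^ 2 * V := by
    intro j
    have h1 := variance_map (μ := gaussianReal (a j) V) (Y := fun y => c j * (y - a j))
      (X := fun y => y) (by fun_prop) (by fun_prop)
    rw [hlaw, variance_fun_id_gaussianReal] at h1
    exact h1.symm
  have hG : HasGaussianLaw (fun x : Fin k → ℝ => ∑ j, c j * (x j - a j))
      (Measure.pi (fun j => gaussianReal (a j) V)) := by
    refine iIndepFun.hasGaussianLaw_fun_sum (X := fun j (x : Fin k → ℝ) => c j * (x j - a j))
      (fun j => ?_) (iIndepFun_pi (X := fun j (y : ℝ) => c j * (y - a j)) fun j => by fun_prop)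
    constructor
    have h2 : (fun x : Fin k → ℝ => c j * (x j - a j)) =
      (fun y => c j * (y - a j)) ∘ (fun x => x j) := rfl
    rw [h2, ← Measure.map_map (by fun_prop) (by fun_prop),
      (measurePreserving_eval (fun j => gaussianReal (a j) V) j).map_eq, hlaw]
    infer_instance
  rw [hG.map_eq_gaussianReal]
  have hm : ∫ x : Fin k → ℝ, ∑ j, c j * (x j - a j)
      ∂(Measure.pi (fun j => gaussianReal (a j) V)) = 0 := by
    rw [integral_finsetSum]
    · refine Finset.sum_eq_zero fun j _ => ?_
      rw [← hmean j]
      exact integral_comp_eval (μ := fun j => gaussianReal (a j) V)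
        (f := fun y => c j * (y - a j)) (by fun_prop)
    · intro j _
      exact ((hmem j).comp_measurePreserving
        (measurePreserving_eval (fun j => gaussianReal (a j) V) j)).integrable (by norm_num)
  have hv := variance_sum_pi (X := fun j y => c j * (y - a j)) hmem
  have he : (∑ j, fun x : Fin k → ℝ => c j * (x j - a j)) =
    fun x => ∑ j, c j * (x j - a j) := by ext x; simp
  rw [he] at hv
  simp only [hvar, h] at hv
  rw [hm, hv]
  simp

lemma aux_main {k : ℕ} (a b : Fin k → ℝ) (σ s ε c : ℝ) (hσ : 0 < σ) (hs : 0 < s)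
    (hsum : ∑ j, (a j - b j)^2 = (σ * s)^2) (hc : 0 < c) (hc2 : 2 * Real.log 1.25 ≤ c^2)
    (h : 2*c^2 - 1 ≤ 2*c*(ε / s - s/2)) (S : Set (Fin k → ℝ)) (hS : MeasurableSet S) :
    Measure.pi (fun j => gaussianReal (a j) ⟨σ ^ 2, sq_nonneg σ⟩) S ≤
      ENNReal.ofReal (Real.exp ε) *
        Measure.pi (fun j => gaussianReal (b j) ⟨σ ^ 2, sq_nonneg σ⟩) S
        + ENNReal.ofReal (1.25 * Real.exp (-c^2/2)) := by
  obtain ⟨V, hV⟩ : ∃ V : NNReal, V = ⟨σ ^ 2, sq_nonneg σ⟩ := ⟨_, rfl⟩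
  have hV' : (V : ℝ) = σ ^ 2 := by rw [hV]; rfl
  rw [← hV]
  have hV0 : V ≠ 0 := by
    intro h0
    rw [h0] at hV'
    have : 0 < σ^2 := by positivity
    simp at hV'
    linarith
  set Y : (Fin k → ℝ) → ℝ := fun x => ∑ j, ((a j - b j) / (σ^2 * s)) * (x j - a j) with hY
  have hYm : Measurable Y := by fun_prop
  have hproj : (Measure.pi (fun j => gaussianReal (a j) V)).map Y = gaussianReal 0 1 := by
    apply aux_proj
    rw [hV', ← Finset.sum_mul]
    simp_rw [div_pow]
    rw [← Finset.sum_div, hsum]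
    field_simp
  have hd : Measure.pi (fun j => gaussianReal (a j) V) =
      (Measure.pi (fun j => gaussianReal (b j) V)).withDensity
        (fun x => ENNReal.ofReal (Real.exp (s * Y x + s^2/2))) := by
    have hi : ∀ j, gaussianReal (a j) V = (gaussianReal (b j) V).withDensity
      (fun x => ENNReal.ofReal (Real.exp (((a j-b j)*(x-b j) - (a j-b j)^2/2)/V))) :=
      fun j => aux_gauss_density _ _ _ hV0
    have : ∀ j, SigmaFinite ((gaussianReal (b j) V).withDensity
      (fun x => ENNReal.ofReal (Real.exp (((a j-b j)*(x-b j) - (a j-b j)^2/2)/V)))) := by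
      intro j
      rw [← hi]; infer_instance
    conv_lhs => rw [show (fun j => gaussianReal (a j) V) = _ from funext hi]
    rw [aux_pi_density (fun j => gaussianReal (b j) V) (fun j x =>
      ENNReal.ofReal (Real.exp (((a j-b j)*(x-b j) - (a j-b j)^2/2)/V))) (fun j => by fun_prop)]
    congr 1
    ext x
    rw [← ENNReal.ofReal_prod_of_nonneg (fun _ _ => by positivity), ← Real.exp_sum]
    congr 2
    have : s^2/2 = ∑ j, (a j - b j)^2 / (2 * σ^2) := by
      rw [← Finset.sum_div, hsum]; field_simp
    rw [this, hY, hV', Finset.mul_sum, ← Finset.sum_add_distrib]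
    refine Finset.sum_congr rfl fun j _ => ?_
    field_simp
    ring
  have hT : MeasurableSet {x | ε / s - s/2 < Y x} := measurableSet_lt measurable_const hYm
  rw [← measure_inter_add_sdiff S hT, add_comm]
  apply add_le_add
  · conv_lhs => rw [hd]
    rw [withDensity_apply _ (hS.diff hT)]
    calc _ ≤ ∫⁻ x in S \ {x | ε / s - s/2 < Y x}, ENNReal.ofReal (Real.exp ε)
          ∂(Measure.pi (fun j => gaussianReal (b j) V)) := by
          refine setLIntegral_mono (by fun_prop) fun x hx => ?_
          apply ENNReal.ofReal_le_ofReal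
          apply Real.exp_le_exp.2
          have h1 : Y x ≤ ε / s - s/2 := not_lt.1 hx.2
          have h2 : s * Y x ≤ s * (ε / s - s/2) := by gcongr
          have h3 : s * (ε / s - s/2) = ε - s^2/2 := by field_simp
          linarith
      _ ≤ _ := by
          rw [setLIntegral_const]
          gcongr
          exact Set.sdiff_subset
  · refine le_trans (measure_mono Set.inter_subset_right) ?_
    refine le_trans (le_of_eq ?_) (aux_tail c (ε / s - s/2) hc hc2 h)
    rw [← hproj, Measure.map_apply hYm measurableSet_Ioi]
    rfl

lemma aux_clip {k : ℕ} (u : EuclideanSpace ℝ (Fin k)) (C : ℝ) (hC : 0 < C) :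
    ‖clip u C‖ ≤ C := by
  unfold clip
  rcases eq_or_ne u 0 with rfl | hu
  · simp [hC.le]
  · have hu' : 0 < ‖u‖ := norm_pos_iff.2 hu
    rw [norm_smul, Real.norm_of_nonneg (by positivity)]
    calc _ ≤ C / ‖u‖ * ‖u‖ := by gcongr; exact min_le_right _ _
      _ = C := by field_simp

lemma aux_fw {Z : Type*} {k n : ℕ} (φ : Z → EuclideanSpace ℝ (Fin k)) (C : ℝ)
    (w : Fin n → ℝ) (D : Fin n → Z) (i : Fin n) (nullz : Z) (hφ : φ nullz = 0) :
    fw φ C w D - fw φ C w (Function.update D i nullz) =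
      (1 / (n : ℝ)) • w i • clip (φ (D i)) C := by
  unfold fw
  rw [← smul_sub, ← Finset.sum_sub_distrib, Finset.sum_eq_single i]
  · simp [hφ, clip]
  · intro j _ hj
    simp [Function.update_of_ne hj]
  · simp

/-- Per-instance bound for the risk-weighted Gaussian release. The mechanism
`M D = ⊗_j N(f_w(D)_j, σ²)` satisfies the `(ε_i, δ_t)` per-instance bound for record `i`
on `D`, where `ε_i = (w_i C/(nσ))·√(2 log(1.25/δ_t)) < 1`. -/
theorem per_instance_weighted_gaussian
    {Z : Type*} {k : ℕ} (nullz : Z) (n : ℕ) (hn : 0 < n)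
    (C σ δt : ℝ) (hC : 0 < C) (hσ : 0 < σ) (hδt0 : 0 < δt) (hδt1 : δt < 1)
    (φ : Z → EuclideanSpace ℝ (Fin k)) (hφ : φ nullz = 0)
    (w : Fin n → ℝ) (hw : ∀ i, 0 < w i ∧ w i ≤ 1)
    (D : Fin n → Z) (i : Fin n)
    (hε : (w i * C / ((n : ℝ) * σ)) * Real.sqrt (2 * Real.log (1.25 / δt)) < 1) :
    ∀ S : Set (Fin k → ℝ), MeasurableSet S →
      Measure.pi (fun j => gaussianReal (fw φ C w D j) ⟨σ ^ 2, sq_nonneg σ⟩) S ≤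
        ENNReal.ofReal
            (Real.exp ((w i * C / ((n : ℝ) * σ)) * Real.sqrt (2 * Real.log (1.25 / δt)))) *
          Measure.pi (fun j =>
            gaussianReal (fw φ C w (Function.update D i nullz) j) ⟨σ ^ 2, sq_nonneg σ⟩) S
        + ENNReal.ofReal δt := by
  intro S hS
  have hn' : (0:ℝ) < n := by exact_mod_cast hn
  have hwi := (hw i).1
  have hlog0 : 0 < Real.log 1.25 := Real.log_pos (by norm_num)
  have hlog : Real.log 1.25 ≤ Real.log (1.25 / δt) := by
    apply Real.log_le_log (by norm_num)
    rw [le_div_iff₀ hδt0]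
    linarith
  set c := Real.sqrt (2 * Real.log (1.25 / δt)) with hcdef
  have hc : 0 < c := Real.sqrt_pos.2 (by linarith)
  have hcsq : c^2 = 2 * Real.log (1.25 / δt) := Real.sq_sqrt (by linarith)
  have hδ : 1.25 * Real.exp (-c^2/2) = δt := by
    rw [hcsq, show -(2 * Real.log (1.25 / δt))/2 = -Real.log (1.25 / δt) by ring, Real.exp_neg,
      Real.exp_log (by positivity)]
    field_simp
  set s0 := w i * C / ((n : ℝ) * σ) with hs0
  have hs0p : 0 < s0 := by positivity
  set v := fw φ C w D - fw φ C w (Function.update D i nullz) with hv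
  have hvn : ‖v‖ ≤ σ * s0 := by
    rw [hv, aux_fw φ C w D i nullz hφ, norm_smul, norm_smul, Real.norm_of_nonneg (by positivity),
      Real.norm_of_nonneg hwi.le]
    calc _ ≤ 1 / (n:ℝ) * (w i * C) := by gcongr; exact aux_clip _ _ hC
      _ = _ := by rw [hs0]; field_simp
  rcases eq_or_ne v 0 with h0 | h0
  · have heq : fw φ C w D = fw φ C w (Function.update D i nullz) := sub_eq_zero.1 h0
    rw [heq]
    refine le_trans ?_ le_self_add
    refine le_mul_of_one_le_left zero_le ?_
    rw [ENNReal.one_le_ofReal]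
    exact Real.one_le_exp (by positivity)
  · have hvp : 0 < ‖v‖ := norm_pos_iff.2 h0
    rw [← hδ]
    have hsp : 0 < ‖v‖ / σ := by positivity
    have hsle : ‖v‖ / σ ≤ s0 := by rw [div_le_iff₀ hσ]; linarith
    refine aux_main (fun j => fw φ C w D j) (fun j => fw φ C w (Function.update D i nullz) j)
      σ (‖v‖ / σ) (s0 * c) c hσ hsp ?_ hc (by linarith) ?_ S hS
    · rw [mul_div_cancel₀ _ hσ.ne', EuclideanSpace.real_norm_sq_eq]
      rfl
    · generalize ‖v‖ / σ = s at hsp hsle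
      have h1 : c ≤ s0 * c / s := by
        rw [le_div_iff₀ hsp]; nlinarith
      nlinarith
end
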